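/- Let R and S be Noetherian local rings and suppose R is a quasi-deformation of S, i.e., there exist elements x₁,…,xₙ forming part of a system of parameters of S and a finite injective ring homomorphism R → S/(x₁,…,xₙ)S. If S admits a balanced big Cohen–Macaulay module Q (a not-necessarily-finitely-generated S-module on which every system of parameters of S is a regular sequence), then Q/(x₁,…,xₙ)Q is a balanced big Cohen–Macaulay module over R; in particular, R admits a big Cohen–Macaulay module. -/

import Mathlib

open IsLocalRing RingTheory.Sequence

section Defs
variable (R : Type*) [CommRing R] [IsLocalRing R]

/-- A (full) system of parameters of a local ring: a list of elements of the maximal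
ideal, of length the Krull dimension, generating an ideal primary to the maximal ideal. -/
def IsSOP (rs : List R) : Prop :=
  (rs.length : WithBot ℕ∞) = ringKrullDim R ∧
  (∀ r ∈ rs, r ∈ maximalIdeal R) ∧
  (Ideal.span {r | r ∈ rs}).radical = maximalIdeal R

variable (M : Type*) [AddCommGroup M] [Module R M]

/-- A big Cohen-Macaulay module: some system of parameters is an `M`-regular sequence
(in particular `M ≠ 𝔪M`). -/
def IsBigCM : Prop := ∃ rs : List R, IsSOP R rs ∧ IsRegular M rs

/-- A balanced big Cohen-Macaulay module: every system of parameters is an `M`-regular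
sequence. -/
def IsBalancedBigCM : Prop := ∀ rs : List R, IsSOP R rs → IsRegular M rs

end Defs

theorem aux_rad {T : Type*} [CommRing T] [IsLocalRing T] (I : Ideal T)
    (hI : I ≤ maximalIdeal T)
    (h : ∀ P : Ideal T, P.IsPrime → I ≤ P → maximalIdeal T ≤ P) :
    I.radical = maximalIdeal T := by
  apply le_antisymm
  · exact (Ideal.IsPrime.radical_le_iff inferInstance).2 hI
  · rw [Ideal.radical_eq_sInf]
    exact le_sInf fun P hP => h P hP.2 hP.1

theorem aux_dim {T : Type*} [CommRing T] [IsLocalRing T] [IsNoetherianRing T] (rs : List T)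
    (h : (Ideal.span {r | r ∈ rs}).radical = maximalIdeal T) :
    ringKrullDim T ≤ rs.length := by
  classical
  rw [← IsLocalRing.maximalIdeal_height_eq_ringKrullDim]
  have hm : maximalIdeal T ∈ (Ideal.span ((rs.toFinset : Finset T) : Set T)).minimalPrimes := by
    have e : ((rs.toFinset : Finset T) : Set T) = {r | r ∈ rs} := by ext; simp
    rw [e]
    refine ⟨⟨inferInstance, h ▸ Ideal.le_radical⟩, fun P hP _ => ?_⟩
    rw [← h]
    exact (Ideal.IsPrime.radical_le_iff hP.1).2 hP.2
  have h1 := Ideal.height_le_card_of_mem_minimalPrimes_span_finset hm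
  have h2 : (maximalIdeal T).height ≤ (rs.length : ℕ∞) :=
    h1.trans (by exact_mod_cast List.toFinset_card_le rs)
  exact_mod_cast h2

theorem aux_exists_sop (T : Type*) [CommRing T] [IsLocalRing T] [IsNoetherianRing T] :
    ∃ rs : List T, IsSOP T rs := by
  obtain ⟨s, hs, hc⟩ := Ideal.exists_finset_card_eq_height_of_isNoetherianRing (maximalIdeal T)
  have e : {r | r ∈ s.toList} = (s : Set T) := by ext; simp
  refine ⟨s.toList, ?_, ?_, ?_⟩
  · rw [← IsLocalRing.maximalIdeal_height_eq_ringKrullDim, ← hc]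
    simp
  · intro r hr
    exact hs.1.2 (Ideal.subset_span (by simpa using hr))
  · rw [e]
    refine aux_rad _ hs.1.2 fun P hP hle => hs.2 ⟨hP, hle⟩ (IsLocalRing.le_maximalIdeal hP.ne_top)

theorem aux_dim_le {R A : Type*} [CommRing R] [CommRing A] (g : R →+* A)
    (hg : Function.Injective g) (hi : g.IsIntegral) : ringKrullDim R ≤ ringKrullDim A := by
  let := g.toAlgebra
  have : Algebra.IsIntegral R A := ⟨hi⟩
  refine iSup_le fun l => ?_
  obtain ⟨P, -, hP, hPc⟩ := Ideal.exists_ideal_over_prime_of_isIntegral (S := A)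
    (RelSeries.head l).asIdeal ⊥ (by
      intro x hx
      have hx' : g x = 0 := hx
      rw [(map_eq_zero_iff g hg).1 hx']
      exact zero_mem _)
  have : P.LiesOver (RelSeries.head l).asIdeal := ⟨hPc.symm⟩
  obtain ⟨L, hL, -⟩ := Ideal.exists_ltSeries_of_hasGoingUp l P
  rw [← hL]
  exact Order.LTSeries.length_le_krullDim L

theorem aux_reg {S Q : Type*} [CommRing S] [AddCommGroup Q] [Module S Q] (xs ss : List S)
    (h : IsRegular Q (xs ++ ss)) :
    IsRegular (Q ⧸ (Ideal.ofList xs • (⊤ : Submodule S Q))) ss := by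
  refine ⟨((isWeaklyRegular_append_iff Q xs ss).1 h.1).2, fun ht => h.2 ?_⟩
  have h1 := congrArg (Submodule.comap (Submodule.mkQ (Ideal.ofList xs • (⊤ : Submodule S Q)))) ht
  have h2 : (⊤ : Submodule S (Q ⧸ (Ideal.ofList xs • (⊤ : Submodule S Q)))) =
      Submodule.map (Submodule.mkQ _) ⊤ := by simp
  rw [h2, ← Submodule.map_smul'', ← h2, Submodule.comap_top, Submodule.comap_map_mkQ] at h1
  rw [Ideal.ofList_append, Submodule.sup_smul]
  exact h1

/--
Let `R` and `S` be Noetherian local rings and suppose `R` is a quasi-deformation of `S`: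
there are elements `x₁,…,xₙ` forming part of a system of parameters of `S` and a finite
injective ring homomorphism `g : R → S/(x₁,…,xₙ)`.  If `Q` is a balanced big
Cohen-Macaulay `S`-module, then `Q/(x₁,…,xₙ)Q` (an `R`-module via `g`) is a balanced big
Cohen-Macaulay `R`-module; in particular `R` admits a big Cohen-Macaulay module.
-/
theorem stmt5 (R S : Type) [CommRing R] [CommRing S] [IsLocalRing R] [IsLocalRing S]
    [IsNoetherianRing R] [IsNoetherianRing S]
    (xs : List S) (hxs : ∃ ys : List S, IsSOP S (xs ++ ys))
    (g : R →+* S ⧸ Ideal.span {s | s ∈ xs})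
    (hginj : Function.Injective g) (hgfin : g.Finite)
    (Q : Type) [AddCommGroup Q] [Module S Q]
    (hQ : IsBalancedBigCM S Q) :
    (@IsBalancedBigCM R _ _
      (Q ⧸ ((Ideal.span {s | s ∈ xs}) • (⊤ : Submodule S Q))) _
      (Module.compHom _ g)) ∧
    ∃ (Q' : Type) (_ : AddCommGroup Q') (_ : Module R Q'), IsBigCM R Q' := by
  have main : @IsBalancedBigCM R _ _
      (Q ⧸ ((Ideal.span {s | s ∈ xs}) • (⊤ : Submodule S Q))) _
      (Module.compHom _ g) := by
    intro rs hrs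
    obtain ⟨ys, hys⟩ := hxs
    have hint : g.IsIntegral := hgfin.to_isIntegral
    have hmk : Function.Surjective (Ideal.Quotient.mk (Ideal.span {s | s ∈ xs})) :=
      Ideal.Quotient.mk_surjective
    have hIm : Ideal.span {s | s ∈ xs} ≤ maximalIdeal S :=
      Ideal.span_le.2 fun s hs => hys.2.1 s (List.mem_append_left _ hs)
    have : Nontrivial (S ⧸ Ideal.span {s | s ∈ xs}) :=
      Ideal.Quotient.nontrivial_iff.2 fun h =>
        (maximalIdeal.isMaximal S).ne_top (top_le_iff.1 (h ▸ hIm))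
    have : IsLocalRing (S ⧸ Ideal.span {s | s ∈ xs}) := IsLocalRing.of_surjective' _ hmk
    have hdimA : ringKrullDim (S ⧸ Ideal.span {s | s ∈ xs}) ≤ ys.length := by
      have := aux_dim (ys.map (Ideal.Quotient.mk (Ideal.span {s | s ∈ xs}))) ?_
      · simpa using this
      refine aux_rad _ ?_ ?_
      · refine Ideal.span_le.2 fun a ha => ?_
        obtain ⟨y, hy, rfl⟩ := List.mem_map.1 ha
        have := IsLocalRing.of_surjective' _ hmk
        have hl : IsLocalHom (Ideal.Quotient.mk (Ideal.span {s | s ∈ xs})) :=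
          IsLocalHom.of_surjective _ hmk
        have := hys.2.1 y (List.mem_append_right _ hy)
        exact fun hu => this (hl.map_nonunit _ hu)
      · intro P hP hle
        have h1 : maximalIdeal S ≤ P.comap (Ideal.Quotient.mk (Ideal.span {s | s ∈ xs})) := by
          rw [← hys.2.2]
          refine (Ideal.IsPrime.radical_le_iff inferInstance).2 (Ideal.span_le.2 fun s hs => ?_)
          rcases List.mem_append.1 hs with hs | hs
          · show Ideal.Quotient.mk (Ideal.span {s | s ∈ xs}) s ∈ P
            have hs' : s ∈ Ideal.span {s | s ∈ xs} := Ideal.subset_span hs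
            rw [Ideal.Quotient.eq_zero_iff_mem.2 hs']
            exact zero_mem _
          · exact hle (Ideal.subset_span (List.mem_map_of_mem hs))
        intro a ha
        obtain ⟨s, rfl⟩ := hmk a
        exact h1 fun hu => ha (hu.map _)
    have hdimR : rs.length ≤ ys.length := by
      have := (aux_dim_le g hginj hint).trans hdimA
      rw [← hrs.1] at this
      exact_mod_cast this
    obtain ⟨h, hh⟩ : ∃ h : R → S, ∀ r, Ideal.Quotient.mk (Ideal.span {s | s ∈ xs}) (h r) = g r :=
      ⟨fun r => Function.surjInv hmk (g r), fun r => Function.surjInv_eq hmk _⟩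
    have hmem : ∀ s ∈ xs ++ rs.map h, s ∈ maximalIdeal S := by
      intro s hs
      rcases List.mem_append.1 hs with hs | hs
      · exact hIm (Ideal.subset_span hs)
      · obtain ⟨r, hr, rfl⟩ := List.mem_map.1 hs
        intro hu
        have hu' := hu.map (Ideal.Quotient.mk (Ideal.span {s | s ∈ xs}))
        rw [hh] at hu'
        have hl := hint.isLocalHom hginj
        exact hrs.2.1 r hr (hl.map_nonunit _ hu')
    have hrad : (Ideal.span {s | s ∈ xs ++ rs.map h}).radical = maximalIdeal S := by
      refine aux_rad _ (Ideal.span_le.2 hmem) fun P hP hle => ?_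
      have hIP : Ideal.span {s | s ∈ xs} ≤ P :=
        Ideal.span_le.2 fun s hs => hle (Ideal.subset_span (List.mem_append_left _ hs))
      have hker : RingHom.ker (Ideal.Quotient.mk (Ideal.span {s | s ∈ xs})) ≤ P := by
        rwa [Ideal.mk_ker]
      have hP' : (P.map (Ideal.Quotient.mk (Ideal.span {s | s ∈ xs}))).IsPrime :=
        Ideal.map_isPrime_of_surjective hmk hker
      have hmR : maximalIdeal R ≤
          (P.map (Ideal.Quotient.mk (Ideal.span {s | s ∈ xs}))).comap g := by
        rw [← hrs.2.2]
        refine (Ideal.IsPrime.radical_le_iff inferInstance).2 (Ideal.span_le.2 fun r hr => ?_)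
        show g r ∈ P.map (Ideal.Quotient.mk (Ideal.span {s | s ∈ xs}))
        rw [← hh]
        exact Ideal.mem_map_of_mem _
          (hle (Ideal.subset_span (List.mem_append_right _ (List.mem_map_of_mem hr))))
      have hmax : ((P.map (Ideal.Quotient.mk (Ideal.span {s | s ∈ xs}))).comap g).IsMaximal := by
        rw [← (maximalIdeal.isMaximal R).eq_of_le (Ideal.IsPrime.ne_top inferInstance) hmR]
        exact maximalIdeal.isMaximal R
      have hM := Ideal.isMaximal_of_isIntegral_of_isMaximal_comap' g hint _ hmax
      have hM2 := Ideal.comap_isMaximal_of_surjective _ hmk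
        (K := P.map (Ideal.Quotient.mk (Ideal.span {s | s ∈ xs})))
      have e : (P.map (Ideal.Quotient.mk (Ideal.span {s | s ∈ xs}))).comap
          (Ideal.Quotient.mk (Ideal.span {s | s ∈ xs})) = P := by
        rw [Ideal.comap_map_of_surjective' _ hmk]
        exact sup_eq_left.2 hker
      rw [e] at hM2
      exact (IsLocalRing.eq_maximalIdeal hM2).ge
    have hsop : IsSOP S (xs ++ rs.map h) := by
      refine ⟨le_antisymm ?_ (aux_dim _ hrad), hmem, hrad⟩
      rw [← hys.1]
      simp only [List.length_append, List.length_map]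
      exact_mod_cast Nat.add_le_add_left hdimR _
    have hreg := aux_reg xs (rs.map h) (hQ _ hsop)
    let : Module R (Q ⧸ ((Ideal.span {s | s ∈ xs}) • (⊤ : Submodule S Q))) :=
      Module.compHom _ g
    refine ((AddEquiv.refl (Q ⧸ ((Ideal.span {s | s ∈ xs}) • (⊤ : Submodule S Q)))).isRegular_congr
      (List.forall₂_map_right_iff.mpr <| List.forall₂_same.mpr fun r _ x => ?_)).2 hreg
    show g r • x = h r • x
    rw [← hh]
    rfl
  refine ⟨main, Q ⧸ ((Ideal.span {s | s ∈ xs}) • (⊤ : Submodule S Q)), inferInstance,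
    Module.compHom _ g, ?_⟩
  obtain ⟨rs, hrs⟩ := aux_exists_sop R
  exact ⟨rs, hrs, main rs hrs⟩
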